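/- arXiv:2108.08481 — 2 statements merged into one kernel-verified Lean document; each statement's English description precedes it below -/
import Mathlib

section
/- Let D' ⊆ ℝ^{d'} be a domain, let 1 ≤ p < ∞, let n ∈ ℕ, and let φ_1, …, φ_n ∈ L^p(D'; ℝ). Define G : ℝ^n → L^p(D'; ℝ) by G(w) = Σ_{j=1}^n w_j φ_j. Then for every compact set K ⊆ ℝ^n, every σ ∈ A_0, and every ε > 0, there exist L ∈ ℕ and a σ-neural network κ ∈ N_L(σ; ℝ^{d'} × ℝ^{d'}, ℝ^{1×n}) such that sup_{w∈K} ‖G(w) − ∫_{D'} κ(·, x) w dx‖_{L^p(D')} ≤ ε, where κ(y, x) w denotes the product of the 1×n matrix κ(y, x) with the vector w ∈ ℝ^n. -/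
open MeasureTheory Filter
open scoped ENNReal BigOperators

noncomputable section

/-- `IsNNRep σ n m f` : `f` is of the form `x ↦ W_n σ(… W_1 σ(W_0 x + b_0) + b_1 …) + b_n`
with output dimension `m`. -/
def IsNNRep (σ : ℝ → ℝ) {ι : Type*} [Fintype ι] :
    ℕ → (m : ℕ) → ((ι → ℝ) → (Fin m → ℝ)) → Prop
  | 0, m, f => ∃ (W : Matrix (Fin m) ι ℝ) (b : Fin m → ℝ),
      f = fun x => W.mulVec x + b
  | n + 1, m, f => ∃ (k : ℕ) (g : (ι → ℝ) → (Fin k → ℝ))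
      (W : Matrix (Fin m) (Fin k) ℝ) (b : Fin m → ℝ),
      IsNNRep σ n k g ∧ f = fun x => W.mulVec (fun i => σ (g x i)) + b

/-- `f` is an `n`-layer real-valued `σ`-neural network. -/
def IsNN (σ : ℝ → ℝ) {ι : Type*} [Fintype ι] (n : ℕ) (f : (ι → ℝ) → ℝ) : Prop :=
  ∃ g : (ι → ℝ) → (Fin 1 → ℝ), IsNNRep σ n 1 g ∧ f = fun x => g x 0

/-- vector-valued neural networks, componentwise. -/
def IsNNV (σ : ℝ → ℝ) {ι : Type*} [Fintype ι] (n : ℕ) {m : ℕ}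
    (f : (ι → ℝ) → (Fin m → ℝ)) : Prop :=
  ∀ i : Fin m, IsNN σ n fun x => f x i

/-- matrix-valued neural networks, entrywise. -/
def IsNNM (σ : ℝ → ℝ) {ι : Type*} [Fintype ι] (n : ℕ) {a b : ℕ}
    (f : (ι → ℝ) → Matrix (Fin a) (Fin b) ℝ) : Prop :=
  ∀ (i : Fin a) (j : Fin b), IsNN σ n fun x => f x i j

/-- The class `A_0` of activation functions. -/
def MemA0 (σ : ℝ → ℝ) : Prop :=
  Continuous σ ∧ ∃ n : ℕ, ∀ (k : ℕ) (K : Set (Fin k → ℝ)), IsCompact K →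
    ∀ f : (Fin k → ℝ) → ℝ, ContinuousOn f K → ∀ ε : ℝ, 0 < ε →
      ∃ g : (Fin k → ℝ) → ℝ, IsNN σ n g ∧ ∀ x ∈ K, |f x - g x| ≤ ε

/-- The class `A^L_0` of linearly bounded activation functions. -/
def MemAL0 (σ : ℝ → ℝ) : Prop :=
  MemA0 σ ∧ Measurable σ ∧ ∃ C : ℝ, ∀ x : ℝ, |σ x| ≤ C * (1 + |x|)

/-- The class `BA` of activations admitting bounded approximations to the identity. -/
def MemBA (σ : ℝ → ℝ) : Prop :=
  MemA0 σ ∧ ∀ (k : ℕ) (K : Set (Fin k → ℝ)), IsCompact K →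
    ∀ ε : ℝ, 0 < ε → ∀ C : ℝ, 0 ≤ C →
      (∀ x ∈ K, ∀ y ∈ K, Real.sqrt (∑ i, (x i - y i) ^ 2) ≤ C) →
      ∃ (n : ℕ) (f : (Fin k → ℝ) → (Fin k → ℝ)), IsNNV σ n f ∧
        (∀ x ∈ K, Real.sqrt (∑ i, (f x i - x i) ^ 2) ≤ ε) ∧
        ∀ x, Real.sqrt (∑ i, (f x i) ^ 2) ≤ C

/-- A domain: bounded, connected, open, topologically regular. -/
def IsRegularDomain {k : ℕ} (D : Set (Fin k → ℝ)) : Prop :=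
  IsOpen D ∧ IsConnected D ∧ Bornology.IsBounded D ∧ interior (closure D) = D

/-- affine kernel integral operators `IO(σ; D, ℝ^{d1}, ℝ^{d2})`. -/
def IsIO (σ : ℝ → ℝ) {d : ℕ} (D : Set (Fin d → ℝ)) (d1 d2 : ℕ)
    (S : ((Fin d → ℝ) → (Fin d1 → ℝ)) → ((Fin d → ℝ) → (Fin d2 → ℝ))) : Prop :=
  ∃ (n1 n2 : ℕ) (κ : ((Fin d ⊕ Fin d) → ℝ) → Matrix (Fin d2) (Fin d1) ℝ)
    (b : (Fin d → ℝ) → (Fin d2 → ℝ)),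
    IsNNM σ n1 κ ∧ IsNNV σ n2 b ∧
    S = fun f x => (∫ y in D, (κ (Sum.elim x y)).mulVec (f y)) + b x

/-- The chain `S_{n-1} σ1 (⋯ S_2 σ1 (S_1 (S_0 f)) ⋯)` of `n` integral operators. -/
inductive NOChain (σ1 σ2 : ℝ → ℝ) {d : ℕ} (D : Set (Fin d → ℝ)) (da : ℕ) :
    ℕ → (m : ℕ) → (((Fin d → ℝ) → (Fin da → ℝ)) → ((Fin d → ℝ) → (Fin m → ℝ))) → Prop
  | base {d0 d1 : ℕ}
      {S0 : ((Fin d → ℝ) → (Fin da → ℝ)) → ((Fin d → ℝ) → (Fin d0 → ℝ))}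
      {S1 : ((Fin d → ℝ) → (Fin d0 → ℝ)) → ((Fin d → ℝ) → (Fin d1 → ℝ))}
      (h0 : IsIO σ2 D da d0 S0) (h1 : IsIO σ2 D d0 d1 S1) :
      NOChain σ1 σ2 D da 2 d1 fun f => S1 (S0 f)
  | step {n m m' : ℕ}
      {V : ((Fin d → ℝ) → (Fin da → ℝ)) → ((Fin d → ℝ) → (Fin m → ℝ))}
      {S : ((Fin d → ℝ) → (Fin m → ℝ)) → ((Fin d → ℝ) → (Fin m' → ℝ))}
      (hV : NOChain σ1 σ2 D da n m V) (hS : IsIO σ2 D m m' S) :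
      NOChain σ1 σ2 D da (n + 1) m' fun f => S fun y i => σ1 (V f y i)

/-- `n`-layer neural operators `NO_n(σ1, σ2, σ3; D, D', ℝ^{da}, ℝ^{du})`. -/
def IsNO (σ1 σ2 σ3 : ℝ → ℝ) {d d' : ℕ} (D : Set (Fin d → ℝ)) (D' : Set (Fin d' → ℝ))
    (da du n : ℕ)
    (G : ((Fin d → ℝ) → (Fin da → ℝ)) → ((Fin d' → ℝ) → (Fin du → ℝ))) : Prop :=
  ∃ (m : ℕ) (V : ((Fin d → ℝ) → (Fin da → ℝ)) → ((Fin d → ℝ) → (Fin m → ℝ)))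
    (l : ℕ) (κ : ((Fin d' ⊕ Fin d) → ℝ) → Matrix (Fin du) (Fin m) ℝ),
    NOChain σ1 σ2 D da n m V ∧ IsNNM σ3 l κ ∧
    G = fun f x => ∫ y in D, (κ (Sum.elim x y)).mulVec (V f y)

open Classical in
/-- Extension by zero of a bounded continuous function on a subset. -/
noncomputable def extendZero {α : Type*} [TopologicalSpace α] {s : Set α}
    (u : BoundedContinuousFunction s ℝ) : α → ℝ :=
  fun x => if h : x ∈ s then u ⟨x, h⟩ else 0


section NeuralNetwork

variable {σ : ℝ → ℝ} {ι ι' : Type*} [Fintype ι] [Fintype ι'] {n : ℕ}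

theorem IsNNRep.continuous (hσ : Continuous σ) {m : ℕ} {f : (ι → ℝ) → (Fin m → ℝ)}
    (hf : IsNNRep σ n m f) : Continuous f := by
  induction n generalizing m with
  | zero =>
    obtain ⟨W, b, rfl⟩ := hf
    exact (continuous_const.matrix_mulVec continuous_id).add continuous_const
  | succ n ih =>
    obtain ⟨k, g, W, b, hg, rfl⟩ := hf
    have := ih hg
    have hg' : Continuous fun x i => σ (g x i) := by fun_prop
    exact (continuous_const.matrix_mulVec hg').add continuous_const

theorem IsNNRep.comp_equiv (e : ι ≃ ι') {m : ℕ} {f : (ι → ℝ) → (Fin m → ℝ)}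
    (hf : IsNNRep σ n m f) : IsNNRep σ n m fun x : ι' → ℝ => f (x ∘ e) := by
  induction n generalizing m with
  | zero =>
    obtain ⟨W, b, rfl⟩ := hf
    refine ⟨W.submatrix id e.symm, b, ?_⟩
    funext x
    rw [Matrix.submatrix_mulVec_equiv]
    rfl
  | succ n ih =>
    obtain ⟨k, g, W, b, hg, rfl⟩ := hf
    exact ⟨k, _, W, b, ih hg, rfl⟩

theorem IsNN.continuous (hσ : Continuous σ) {f : (ι → ℝ) → ℝ} (hf : IsNN σ n f) :
    Continuous f := by
  obtain ⟨g, hg, rfl⟩ := hf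
  exact (continuous_apply 0).comp (hg.continuous hσ)

theorem IsNN.comp_equiv (e : ι ≃ ι') {f : (ι → ℝ) → ℝ} (hf : IsNN σ n f) :
    IsNN σ n fun x : ι' → ℝ => f (x ∘ e) := by
  obtain ⟨g, hg, rfl⟩ := hf
  exact ⟨_, hg.comp_equiv e, rfl⟩

end NeuralNetwork

/-- The activations in `A_0` have networks of one fixed depth that are dense in the continuous
functions, over inputs indexed by any finite type. -/
theorem MemA0.exists_depth {σ : ℝ → ℝ} (hσ : MemA0 σ) :
    ∃ L : ℕ, ∀ (ι : Type) [Fintype ι] (K : Set (ι → ℝ)), IsCompact K →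
      ∀ f : (ι → ℝ) → ℝ, Continuous f → ∀ ε : ℝ, 0 < ε →
        ∃ g : (ι → ℝ) → ℝ, IsNN σ L g ∧ ∀ x ∈ K, |f x - g x| ≤ ε := by
  obtain ⟨-, L, hL⟩ := hσ
  refine ⟨L, fun ι _ K hK f hf ε hε => ?_⟩
  have e : Fin (Fintype.card ι) ≃ ι := (Fintype.equivFin ι).symm
  have hc : Continuous fun x : ι → ℝ => x ∘ e := by fun_prop
  have hc' : Continuous fun x : Fin (Fintype.card ι) → ℝ => x ∘ e.symm := by fun_prop
  obtain ⟨g, hg, hfg⟩ := hL _ _ (hK.image hc) (fun x => f (x ∘ e.symm))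
    (hf.comp hc').continuousOn ε hε
  refine ⟨_, hg.comp_equiv e, fun x hx => ?_⟩
  simpa [Function.comp_assoc] using hfg _ ⟨x, hx, rfl⟩

section KernelIntegral

variable {d : ℕ} {D : Set (Fin d → ℝ)}

theorem continuous_uncurry_sumElim :
    Continuous fun z : (Fin d → ℝ) × (Fin d → ℝ) => Sum.elim z.1 z.2 := by
  refine continuous_pi fun i => ?_
  rcases i with i | i <;> simp only [Sum.elim_inl, Sum.elim_inr] <;> fun_prop

theorem stronglyMeasurable_kernel_integral (hD : Bornology.IsBounded D)
    {κ : (Fin d ⊕ Fin d → ℝ) → ℝ} (hκ : Continuous κ) :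
    StronglyMeasurable fun y => ∫ x in D, κ (Sum.elim y x) := by
  have : IsFiniteMeasure ((volume : Measure (Fin d → ℝ)).restrict D) :=
    isFiniteMeasure_restrict.2 hD.measure_lt_top.ne
  exact (hκ.comp continuous_uncurry_sumElim).stronglyMeasurable.integral_prod_right'

/-- A function in `L^p` of a bounded open set is approximated by the integral of a network kernel:
divide a continuous approximation by the volume and approximate the quotient uniformly. -/
theorem exists_nn_kernel_eLpNorm_sub_le {σ : ℝ → ℝ} (hσ : Continuous σ) {L : ℕ}
    (hL : ∀ (K : Set (Fin d ⊕ Fin d → ℝ)), IsCompact K →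
      ∀ f : (Fin d ⊕ Fin d → ℝ) → ℝ, Continuous f → ∀ ε : ℝ, 0 < ε →
        ∃ g : (Fin d ⊕ Fin d → ℝ) → ℝ, IsNN σ L g ∧ ∀ x ∈ K, |f x - g x| ≤ ε)
    (hD : IsOpen D) (hne : D.Nonempty) (hb : Bornology.IsBounded D)
    {p : ℝ≥0∞} (hp1 : 1 ≤ p) (hp : p ≠ ∞) {φ : (Fin d → ℝ) → ℝ}
    (hφ : MemLp φ p (volume.restrict D)) {ε : ℝ} (hε : 0 < ε) :
    ∃ κ : (Fin d ⊕ Fin d → ℝ) → ℝ, IsNN σ L κ ∧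
      eLpNorm (fun y => φ y - ∫ x in D, κ (Sum.elim y x)) p (volume.restrict D)
        ≤ ENNReal.ofReal ε := by
  have hfin : (volume : Measure (Fin d → ℝ)) D ≠ ∞ := hb.measure_lt_top.ne
  have : IsFiniteMeasure ((volume : Measure (Fin d → ℝ)).restrict D) :=
    isFiniteMeasure_restrict.2 hfin
  set V : ℝ := volume.real D with hV
  have hV0 : 0 < V := ENNReal.toReal_pos (hD.measure_pos volume hne).ne' hfin
  set A : ℝ := V ^ p.toReal⁻¹ with hA
  have hA0 : 0 < A := Real.rpow_pos_of_pos hV0 _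
  obtain ⟨g, hg, hgL⟩ := hφ.exists_boundedContinuous_eLpNorm_sub_le hp
    (ε := ENNReal.ofReal (ε / 2)) (by simpa using hε)
  have hδ : 0 < ε / 2 / (A * V) := by positivity
  obtain ⟨κ, hκ, hκg⟩ := hL ((fun z : (Fin d → ℝ) × (Fin d → ℝ) => Sum.elim z.1 z.2) ''
      (closure D ×ˢ closure D))
    ((hb.isCompact_closure.prod hb.isCompact_closure).image continuous_uncurry_sumElim)
    (fun z => g (z ∘ Sum.inl) / V) (by fun_prop) _ hδ
  refine ⟨κ, hκ, ?_⟩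
  have hκc := hκ.continuous hσ
  have hbound : ∀ y ∈ D, ‖g y - ∫ x in D, κ (Sum.elim y x)‖ ≤ ε / 2 / A := by
    intro y hy
    have hint : IntegrableOn (fun x => κ (Sum.elim y x)) D := by
      refine (Continuous.continuousOn ?_).integrableOn_compact hb.isCompact_closure
        |>.mono_set subset_closure
      exact hκc.comp (continuous_uncurry_sumElim.comp (Continuous.prodMk_right y))
    have hc : g y = ∫ _ in D, g y / V := by
      rw [setIntegral_const, smul_eq_mul, ← hV]
      field_simp
    rw [hc, ← integral_sub (integrable_const _) hint]
    refine (norm_setIntegral_le_of_norm_le_const hb.measure_lt_top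
      (C := ε / 2 / (A * V)) fun x hx => ?_).trans_eq ?_
    · exact hκg _ ⟨(y, x), ⟨subset_closure hy, subset_closure hx⟩, rfl⟩
    · rw [← hV]
      field_simp
  have hsecond : eLpNorm (fun y => g y - ∫ x in D, κ (Sum.elim y x)) p (volume.restrict D)
      ≤ ENNReal.ofReal (ε / 2) := by
    refine (eLpNorm_le_of_ae_bound
      ((ae_restrict_iff' hD.measurableSet).2 (.of_forall hbound))).trans_eq ?_
    have hVD : volume D = ENNReal.ofReal V := (ENNReal.ofReal_toReal hfin).symm
    rw [Measure.restrict_apply_univ, hVD, ENNReal.ofReal_rpow_of_pos hV0, ← hA,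
      ← ENNReal.ofReal_mul hA0.le]
    congr 1
    field_simp
  have hsplit : (fun y => φ y - ∫ x in D, κ (Sum.elim y x))
      = (φ - g) + fun y => g y - ∫ x in D, κ (Sum.elim y x) := by
    funext y
    simp
  rw [hsplit]
  refine (eLpNorm_add_le (hφ.1.sub hgL.1)
    (hgL.1.sub (stronglyMeasurable_kernel_integral hb hκc).aestronglyMeasurable) hp1).trans ?_
  refine (add_le_add hg hsecond).trans_eq ?_
  rw [← ENNReal.ofReal_add (by positivity) (by positivity), add_halves]

end KernelIntegral

/-- The linear expansion map `w ↦ Σ_j w_j φ_j` into `L^p(D'; ℝ)` can be approximated,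
uniformly over a compact set of coefficient vectors, by a neural-network kernel
integral operator applied to constant functions (Lemma D.2, `L^p` case). -/
theorem expansion_approx_by_nn_kernel_Lp
    (d' n : ℕ) (D' : Set (Fin d' → ℝ)) (hD' : IsRegularDomain D')
    (p : ℝ≥0∞) [Fact (1 ≤ p)] (hp : p ≠ ∞)
    (φ : Fin n → Lp ℝ p ((volume : Measure (Fin d' → ℝ)).restrict D'))
    (K : Set (Fin n → ℝ)) (hK : IsCompact K)
    (σ : ℝ → ℝ) (hσ : MemA0 σ) (ε : ℝ) (hε : 0 < ε) :
    ∃ (L : ℕ) (κ : ((Fin d' ⊕ Fin d') → ℝ) → Matrix (Fin 1) (Fin n) ℝ),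
      IsNNM σ L κ ∧
      ∀ w ∈ K,
        eLpNorm
          (fun y => (∑ j : Fin n, w j • φ j) y
            - ∑ j : Fin n, (∫ x in D', κ (Sum.elim y x) 0 j) * w j)
          p ((volume : Measure (Fin d' → ℝ)).restrict D') ≤ ENNReal.ofReal ε := by
  obtain ⟨hopen, hconn, hb, -⟩ := hD'
  obtain ⟨L, hL⟩ := hσ.exists_depth
  obtain ⟨C, hC0, hC⟩ := hK.isBounded.exists_pos_norm_le
  have hδ : 0 < ε / ((n + 1) * C) := by positivity
  choose κ hκ hκφ using fun j => exists_nn_kernel_eLpNorm_sub_le hσ.1 (hL (Fin d' ⊕ Fin d'))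
    hopen hconn.nonempty hb Fact.out hp (Lp.memLp (φ j)) hδ
  refine ⟨L, fun z => Matrix.of fun _ j => κ j z, fun _ j => hκ j, fun w hw => ?_⟩
  have hsum : (fun y => (∑ j, w j • φ j : Lp ℝ p (volume.restrict D')) y
        - ∑ j, (∫ x in D', (Matrix.of fun (_ : Fin 1) j => κ j (Sum.elim y x)) 0 j) * w j)
      =ᵐ[volume.restrict D'] ∑ j, w j • fun y => φ j y - ∫ x in D', κ j (Sum.elim y x) := by
    have hsmul : ∀ᵐ y ∂volume.restrict D', ∀ j, (w j • φ j : Lp ℝ p (volume.restrict D')) y = w j * φ j y :=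
      ae_all_iff.2 fun j => Lp.coeFn_smul (w j) (φ j)
    filter_upwards [Lp.coeFn_finsetSum Finset.univ fun j => w j • φ j, hsmul] with y hy hy'
    simp only [hy, Finset.sum_apply, hy', Pi.smul_apply, smul_eq_mul, Matrix.of_apply,
      ← Finset.sum_sub_distrib]
    exact Finset.sum_congr rfl fun j _ => by ring
  refine (eLpNorm_congr_ae hsum).trans_le ?_
  have hmeas : ∀ j, AEStronglyMeasurable (fun y => φ j y - ∫ x in D', κ j (Sum.elim y x))
      (volume.restrict D') :=
    fun j => (Lp.aestronglyMeasurable _).sub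
      (stronglyMeasurable_kernel_integral hb ((hκ j).continuous hσ.1)).aestronglyMeasurable
  calc eLpNorm (∑ j, w j • fun y => φ j y - ∫ x in D', κ j (Sum.elim y x)) p (volume.restrict D')
      ≤ ∑ j, eLpNorm (w j • fun y => φ j y - ∫ x in D', κ j (Sum.elim y x)) p (volume.restrict D') :=
        eLpNorm_sum_le (fun j _ => (hmeas j).const_smul _) Fact.out
    _ ≤ ∑ _j : Fin n, ENNReal.ofReal (ε / (n + 1)) := by
        refine Finset.sum_le_sum fun j _ => ?_
        rw [eLpNorm_const_smul, ← ofReal_norm]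
        refine (mul_le_mul' (ENNReal.ofReal_le_ofReal
          ((norm_le_pi_norm w j).trans (hC w hw))) (hκφ j)).trans_eq ?_
        rw [← ENNReal.ofReal_mul hC0.le]
        congr 1
        field_simp
    _ ≤ ENNReal.ofReal ε := by
        rw [Finset.sum_const, Finset.card_univ, Fintype.card_fin, ← ENNReal.ofReal_nsmul,
          nsmul_eq_mul]
        refine ENNReal.ofReal_le_ofReal ?_
        rw [mul_div_assoc', div_le_iff₀ (by positivity)]
        nlinarith

end
end

section
/- Let D' ⊆ ℝ^{d'} be a domain, let n ∈ ℕ, and let φ_1, …, φ_n ∈ C(cl D'; ℝ). Define G : ℝ^n → C(cl D'; ℝ) by G(w) = Σ_{j=1}^n w_j φ_j. Then for every compact set K ⊆ ℝ^n, every σ ∈ A_0, and every ε > 0, there exist L ∈ ℕ and a σ-neural network κ ∈ N_L(σ; ℝ^{d'} × ℝ^{d'}, ℝ^{1×n}) such that sup_{w∈K} sup_{y∈cl D'} |G(w)(y) − ∫_{D'} κ(y, x) w dx| ≤ ε, where κ(y, x) w denotes the product of the 1×n matrix κ(y, x) with the vector w ∈ ℝ^n. -/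
open MeasureTheory Filter
open scoped ENNReal BigOperators

noncomputable section

theorem IsNNRep.comp_mulVec {σ : ℝ → ℝ} {ι ι' : Type*} [Fintype ι] [Fintype ι']
    (A : Matrix ι ι' ℝ) {n m : ℕ} {f : (ι → ℝ) → (Fin m → ℝ)} (hf : IsNNRep σ n m f) :
    IsNNRep σ n m fun x => f (A.mulVec x) := by
  induction n generalizing m with
  | zero =>
    obtain ⟨W, b, rfl⟩ := hf
    exact ⟨W * A, b, by simp only [Matrix.mulVec_mulVec]⟩
  | succ n ih =>
    obtain ⟨k, g, W, b, hg, rfl⟩ := hf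
    exact ⟨k, _, W, b, ih hg, rfl⟩

/-- Adding inert input coordinates to a neural network yields a neural network. -/
theorem IsNN.comp_inl {σ : ℝ → ℝ} {ι ι' : Type*} [Fintype ι] [Fintype ι']
    {n : ℕ} {f : (ι → ℝ) → ℝ} (hf : IsNN σ n f) :
    IsNN σ n fun x : (ι ⊕ ι') → ℝ => f (x ∘ Sum.inl) := by
  classical
  obtain ⟨g, hg, rfl⟩ := hf
  refine ⟨_, hg.comp_mulVec (Matrix.fromCols 1 (0 : Matrix ι ι' ℝ)), ?_⟩
  simp [Matrix.fromCols_mulVec]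

theorem continuousOn_extendZero {α : Type*} [TopologicalSpace α] {s : Set α}
    (u : BoundedContinuousFunction s ℝ) : ContinuousOn (extendZero u) s := by
  rw [continuousOn_iff_continuous_domRestrict]
  convert u.continuous using 1
  ext x
  simp [extendZero]

theorem IsRegularDomain.measureReal_pos {k : ℕ} {D : Set (Fin k → ℝ)}
    (hD : IsRegularDomain D) : 0 < volume.real D :=
  ENNReal.toReal_pos (hD.1.measure_pos volume hD.2.1.nonempty).ne'
    hD.2.2.1.measure_lt_top.ne

/-- The linear expansion map `w ↦ Σ_j w_j φ_j` into `C(cl D'; ℝ)` can be approximated,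
uniformly over a compact set of coefficient vectors and in supremum norm, by a
neural-network kernel integral operator applied to constant functions
(Lemma D.2, continuous case). -/
theorem expansion_approx_by_nn_kernel_C
    (d' n : ℕ) (D' : Set (Fin d' → ℝ)) (hD' : IsRegularDomain D')
    (φ : Fin n → BoundedContinuousFunction (closure D') ℝ)
    (K : Set (Fin n → ℝ)) (hK : IsCompact K)
    (σ : ℝ → ℝ) (hσ : MemA0 σ) (ε : ℝ) (hε : 0 < ε) :
    ∃ (L : ℕ) (κ : ((Fin d' ⊕ Fin d') → ℝ) → Matrix (Fin 1) (Fin n) ℝ),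
      IsNNM σ L κ ∧
      ∀ w ∈ K, ∀ y, ∀ hy : y ∈ closure D',
        |(∑ j : Fin n, w j * φ j ⟨y, hy⟩)
          - ∑ j : Fin n, (∫ x in D', κ (Sum.elim y x) 0 j) * w j| ≤ ε := by
  have hV := hD'.measureReal_pos
  set V := volume.real D' with hVdef
  obtain ⟨M, hM0, hM⟩ := hK.isBounded.exists_pos_norm_le
  have hc : IsCompact (closure D') := hD'.2.2.1.isCompact_closure
  obtain ⟨-, L, hL⟩ := hσ
  have hden : 0 < (n : ℝ) * M + 1 := by positivity
  choose g hg hgφ using fun j => hL d' (closure D') hc (fun x => extendZero (φ j) x / V)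
    ((continuousOn_extendZero (φ j)).div_const V) (ε / (n * M + 1) / V) (by positivity)
  refine ⟨L, fun x => Matrix.of fun _ j => g j (x ∘ Sum.inl), fun _ j => (hg j).comp_inl, ?_⟩
  intro w hw y hy
  have hint : ∀ j, |φ j ⟨y, hy⟩ - V * g j y| ≤ ε / (n * M + 1) := by
    intro j
    have h := hgφ j y hy
    rw [extendZero, dif_pos hy, le_div_iff₀ hV] at h
    calc |φ j ⟨y, hy⟩ - V * g j y| = |φ j ⟨y, hy⟩ / V - g j y| * V := by
          rw [← abs_of_pos hV, ← abs_mul, abs_of_pos hV]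
          congr 1
          field_simp
      _ ≤ _ := h
  simp only [Matrix.of_apply, Sum.elim_comp_inl, setIntegral_const, smul_eq_mul, ← hVdef]
  calc |(∑ j, w j * φ j ⟨y, hy⟩) - ∑ j, V * g j y * w j|
      = |∑ j, w j * (φ j ⟨y, hy⟩ - V * g j y)| := by
        rw [← Finset.sum_sub_distrib]
        congr 1
        exact Finset.sum_congr rfl fun j _ => by ring
    _ ≤ ∑ j, |w j * (φ j ⟨y, hy⟩ - V * g j y)| := Finset.abs_sum_le_sum_abs _ _
    _ ≤ ∑ _j : Fin n, M * (ε / (n * M + 1)) := by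
        refine Finset.sum_le_sum fun j _ => ?_
        rw [abs_mul]
        exact mul_le_mul ((norm_le_pi_norm w j).trans (hM w hw)) (hint j) (abs_nonneg _) hM0.le
    _ = n * M * ε / (n * M + 1) := by
        rw [Finset.sum_const, Finset.card_univ, Fintype.card_fin, nsmul_eq_mul]
        ring
    _ ≤ ε := by
        rw [div_le_iff₀ hden]
        linarith

end
end
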